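/- Let (W,S) be a Coxeter system of rank 3 with S = {r,s,t}, in which rt = tr (the product rt has order 2) and the orders m_{sr} of sr and m_{st} of st both satisfy m_{sr} ≥ 4 and m_{st} ≥ 4 (possibly infinite). Then there is no element w of W admitting elements w₁, w₂ ∈ W with w = w₁·t, ℓ(w) = ℓ(w₁) + 1, and w = w₂·r·s, ℓ(w) = ℓ(w₂) + 2. -/

import Mathlib

open LaurentPolynomial

namespace CoxeterSystem

variable {B W : Type*} [Group W] {M : CoxeterMatrix B} (cs : CoxeterSystem M W)

theorem functionEnd_mul_apply {α : Type*} (f g : Function.End α) (a : α) :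
    (f * g) a = f (g a) := rfl

open Classical in
/-- The map conjugating by `cs.simple i` and flipping the sign exactly at `cs.simple i`. -/
noncomputable def signedConj (i : B) : Function.End (W × ZMod 2) := fun p ↦
  (cs.simple i * p.1 * cs.simple i, p.2 + if cs.simple i = p.1 then 1 else 0)

open Classical in
theorem signedConj_apply (i : B) (x : W) (ε : ZMod 2) :
    cs.signedConj i (x, ε) =
      (cs.simple i * x * cs.simple i, ε + if cs.simple i = x then 1 else 0) := rfl

theorem simple_mul_pow_mul_simple (i j : B) (k : ℕ) :
    cs.simple j * (cs.simple i * cs.simple j) ^ k * cs.simple j =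
      ((cs.simple i * cs.simple j) ^ k)⁻¹ := by
  have h : cs.simple j * (cs.simple i * cs.simple j) * (cs.simple j)⁻¹ =
      (cs.simple i * cs.simple j)⁻¹ := by simp [mul_assoc]
  have := conj_pow (i := k) (a := cs.simple j) (b := cs.simple i * cs.simple j)
  rw [h, inv_simple] at this
  rw [← this, inv_pow]

open Classical in
theorem signedConj_mul_pow_apply (i j : B) (k : ℕ) (x : W) (ε : ZMod 2) :
    ((cs.signedConj i * cs.signedConj j) ^ k) (x, ε) =
      ((cs.simple i * cs.simple j) ^ k * x * ((cs.simple i * cs.simple j) ^ k)⁻¹,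
        ε + ∑ n ∈ Finset.range (2 * k),
          if cs.simple j * (cs.simple i * cs.simple j) ^ n = x then 1 else 0) := by
  induction k with
  | zero => simp [Function.End.one_def]
  | succ k ih =>
    have key := cs.simple_mul_pow_mul_simple i j k
    have hj : cs.simple j * (cs.simple i * cs.simple j) ^ k =
        ((cs.simple i * cs.simple j) ^ k)⁻¹ * cs.simple j := by
      rw [← key]; simp [mul_assoc]
    have h₁ : cs.simple j = (cs.simple i * cs.simple j) ^ k * x *
          ((cs.simple i * cs.simple j) ^ k)⁻¹ ↔
        cs.simple j * (cs.simple i * cs.simple j) ^ (2 * k) = x := by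
      rw [eq_mul_inv_iff_mul_eq, eq_comm, ← eq_inv_mul_iff_mul_eq, eq_comm, two_mul, pow_add,
        ← mul_assoc, ← mul_assoc, hj]
    have h₂ : cs.simple i = cs.simple j * ((cs.simple i * cs.simple j) ^ k * x *
          ((cs.simple i * cs.simple j) ^ k)⁻¹) * cs.simple j ↔
        cs.simple j * (cs.simple i * cs.simple j) ^ (2 * k + 1) = x := by
      have e : cs.simple j * (cs.simple i * cs.simple j) ^ (2 * k + 1) =
          ((cs.simple i * cs.simple j) ^ k)⁻¹ * (cs.simple j * cs.simple i * cs.simple j) *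
            (cs.simple i * cs.simple j) ^ k := by
        rw [show 2 * k + 1 = k + (1 + k) by omega, pow_add, pow_add, ← mul_assoc, hj]
        simp [mul_assoc]
      rw [e, mul_assoc (_⁻¹), inv_mul_eq_iff_eq_mul, ← eq_mul_inv_iff_mul_eq]
      constructor
      · intro h
        calc cs.simple j * cs.simple i * cs.simple j
            = cs.simple j * (cs.simple j * ((cs.simple i * cs.simple j) ^ k * x *
                ((cs.simple i * cs.simple j) ^ k)⁻¹) * cs.simple j) * cs.simple j := by rw [← h]
          _ = _ := by simp [mul_assoc]
      · intro h
        rw [← h]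
        simp [mul_assoc]
    rw [pow_succ', functionEnd_mul_apply, ih, functionEnd_mul_apply,
      signedConj_apply, signedConj_apply, Prod.mk.injEq]
    constructor
    · rw [pow_succ']
      simp [mul_assoc]
    · simp only [h₁, h₂]
      rw [show 2 * (k + 1) = 2 * k + 1 + 1 by omega, Finset.sum_range_succ,
        Finset.sum_range_succ]
      ring

theorem isLiftable_signedConj : M.IsLiftable cs.signedConj := by
  classical
  intro i j
  funext ⟨x, ε⟩
  rw [signedConj_mul_pow_apply, two_mul, Finset.sum_range_add]
  simp only [pow_add, cs.simple_mul_simple_pow, one_mul, CharTwo.add_self_eq_zero]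
  simp [Function.End.one_def]

/-- The action of `W` on signed group elements whose generators act by `signedConj`. -/
noncomputable def signedConjHom : W →* Function.End (W × ZMod 2) :=
  cs.lift ⟨cs.signedConj, cs.isLiftable_signedConj⟩

theorem signedConjHom_simple (i : B) : cs.signedConjHom (cs.simple i) = cs.signedConj i :=
  cs.lift_apply_simple cs.isLiftable_signedConj i

open Classical in
theorem signedConjHom_wordProd_apply (ω : List B) (x : W) (ε : ZMod 2) :
    cs.signedConjHom (cs.wordProd ω) (x, ε) =
      (cs.wordProd ω * x * (cs.wordProd ω)⁻¹, ε + (cs.rightInvSeq ω).count x) := by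
  induction ω with
  | nil => simp [Function.End.one_def]
  | cons i ω ih =>
    have h : cs.simple i = cs.wordProd ω * x * (cs.wordProd ω)⁻¹ ↔
        (cs.wordProd ω)⁻¹ * cs.simple i * cs.wordProd ω = x := by
      rw [eq_mul_inv_iff_mul_eq, mul_assoc, inv_mul_eq_iff_eq_mul]
    rw [wordProd_cons, map_mul, functionEnd_mul_apply, ih,
      signedConjHom_simple, signedConj_apply, rightInvSeq, List.count_cons, Prod.mk.injEq]
    constructor
    · simp [mul_assoc]
    · simp only [h, beq_iff_eq]
      push_cast
      ring

theorem mem_rightInvSeq_of_isRightDescent {ω : List B} {i : B}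
    (h : cs.IsRightDescent (cs.wordProd ω) i) : cs.simple i ∈ cs.rightInvSeq ω := by
  classical
  by_contra hmem
  obtain ⟨τ, hτ, hτω⟩ := cs.exists_isReduced (cs.wordProd ω * cs.simple i)
  have h₁ : cs.signedConjHom (cs.wordProd ω * cs.simple i) (cs.simple i, 0) =
      cs.signedConjHom (cs.wordProd ω) (cs.simple i, 1) := by
    rw [map_mul, functionEnd_mul_apply, signedConjHom_simple,
      signedConj_apply]
    simp
  rw [hτω, signedConjHom_wordProd_apply, signedConjHom_wordProd_apply,
    List.count_eq_zero_of_not_mem hmem] at h₁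
  have h₂ := congrArg Prod.snd h₁
  have hmem' : cs.simple i ∈ cs.rightInvSeq τ := by
    by_contra hn
    rw [List.count_eq_zero_of_not_mem hn] at h₂
    simp at h₂
  have h₃ := (cs.isRightInversion_of_mem_rightInvSeq hτ hmem').2
  rw [← hτω, simple_mul_simple_cancel_right] at h₃
  exact absurd h (not_lt.mpr h₃.le)

/-- The exchange property. -/
theorem exists_wordProd_eraseIdx_of_isRightDescent {ω : List B} {i : B}
    (h : cs.IsRightDescent (cs.wordProd ω) i) :
    ∃ j < ω.length, cs.wordProd ω * cs.simple i = cs.wordProd (ω.eraseIdx j) := by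
  obtain ⟨j, hj, hji⟩ := List.getElem_of_mem (cs.mem_rightInvSeq_of_isRightDescent h)
  refine ⟨j, by simpa using hj, ?_⟩
  rw [← wordProd_mul_getD_rightInvSeq, List.getD_eq_getElem _ _ hj, hji]

/-- Exchange relative to a given reduced suffix `u` of `w`: a right descent `i` either extends the
suffix or is exchanged with a letter of `u`. -/
theorem exists_suffix_concat_or_eraseIdx {w x : W} {u : List B} {i : B}
    (hw : w = x * cs.wordProd u) (hl : cs.length w = cs.length x + u.length)
    (h : cs.IsRightDescent w i) :
    (∃ y, w = y * cs.wordProd (u ++ [i]) ∧ cs.length w = cs.length y + (u ++ [i]).length) ∨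
      ∃ j < u.length, cs.wordProd u * cs.simple i = cs.wordProd (u.eraseIdx j) := by
  obtain ⟨ω, hω, rfl⟩ := cs.exists_isReduced x
  rw [← wordProd_append] at hw
  subst hw
  obtain ⟨j, hj, hji⟩ := cs.exists_wordProd_eraseIdx_of_isRightDescent h
  rcases lt_or_ge j ω.length with hlt | hge
  · left
    rw [List.eraseIdx_append_of_lt_length hlt, wordProd_append cs (ω.eraseIdx j)] at hji
    have e : cs.wordProd (ω ++ u) = cs.wordProd (ω.eraseIdx j) * cs.wordProd (u ++ [i]) := by
      rw [wordProd_append cs u, ← mul_assoc, ← hji]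
      simp
    refine ⟨_, e, ?_⟩
    have h₁ := cs.length_wordProd_le (ω.eraseIdx j)
    rw [List.length_eraseIdx_of_lt hlt] at h₁
    have h₂ := cs.length_mul_le (cs.wordProd (ω.eraseIdx j)) (cs.wordProd (u ++ [i]))
    have h₃ := cs.length_wordProd_le (u ++ [i])
    rw [← e] at h₂
    have h₄ := hω.eq
    simp only [List.length_append, List.length_singleton] at h₃ ⊢
    omega
  · right
    rw [List.length_append] at hj
    refine ⟨j - ω.length, by omega, ?_⟩
    rw [List.eraseIdx_append_of_length_le hge, wordProd_append, wordProd_append, mul_assoc] at hji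
    exact mul_left_cancel hji

theorem exists_eq_mul_two_of_isRightDescent {w : W} {i j : B} (hij : cs.simple i ≠ cs.simple j)
    (hi : cs.IsRightDescent w i) (hj : cs.IsRightDescent w j) :
    ∃ x, w = x * cs.wordProd [i, j] ∧ cs.length w = cs.length x + 2 := by
  obtain ⟨x, hx, hxl⟩ | ⟨k, hk, -⟩ :=
    cs.exists_suffix_concat_or_eraseIdx (x := w) (u := []) (by simp) (by simp) hi
  swap
  · simp at hk
  obtain h | ⟨k, hk, e⟩ := cs.exists_suffix_concat_or_eraseIdx hx hxl hj
  · exact h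
  · obtain rfl : k = 0 := by simpa using hk
    refine absurd ?_ hij
    simpa [mul_eq_one_iff_eq_inv] using e

theorem exists_eq_mul_four_of_isRightDescent {w : W} {i j : B}
    (hij : orderOf (cs.simple i * cs.simple j) = 0 ∨ 4 ≤ orderOf (cs.simple i * cs.simple j))
    (hi : cs.IsRightDescent w i) (hj : cs.IsRightDescent w j) :
    ∃ x, w = x * cs.wordProd [i, j, i, j] ∧ cs.length w = cs.length x + 4 := by
  have hpow : ∀ k, 0 < k → k < 4 → (cs.simple i * cs.simple j) ^ k ≠ 1 := fun k hk hk4 h ↦ by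
    have h₁ := orderOf_dvd_of_pow_eq_one h
    rcases hij with h0 | h4
    · rw [h0, zero_dvd_iff] at h₁
      omega
    · have := Nat.le_of_dvd hk h₁
      omega
  have hne : cs.simple i ≠ cs.simple j := fun h ↦ hpow 1 one_pos (by omega) (by simp [h])
  obtain ⟨x, hx, hxl⟩ := cs.exists_eq_mul_two_of_isRightDescent hne hi hj
  obtain ⟨x, hx, hxl⟩ | ⟨k, hk, e⟩ :=
    cs.exists_suffix_concat_or_eraseIdx hx (by simpa using hxl) hi
  swap
  · simp only [List.length_cons, List.length_nil] at hk
    exfalso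
    interval_cases k
    · apply hpow 2 (by omega) (by omega)
      simp only [List.eraseIdx, wordProd_cons, wordProd_nil, mul_one] at e
      rw [pow_two, ← mul_assoc, e]
      simp
    · apply hpow 1 (by omega) (by omega)
      simp only [List.eraseIdx, wordProd_cons, wordProd_nil, mul_one] at e
      rw [mul_assoc, mul_eq_left] at e
      rw [pow_one, mul_eq_one_comm.1 e]
  obtain ⟨x, hx, hxl⟩ | ⟨k, hk, e⟩ := cs.exists_suffix_concat_or_eraseIdx hx hxl hj
  · exact ⟨x, by simpa using hx, by simpa using hxl⟩
  · simp only [List.cons_append, List.nil_append, List.length_cons, List.length_nil] at hk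
    exfalso
    interval_cases k
    · apply hpow 3 (by omega) (by omega)
      simp only [List.cons_append, List.nil_append, List.eraseIdx, wordProd_cons, wordProd_nil,
        mul_one] at e
      rw [mul_assoc, mul_assoc, ← mul_assoc, ← pow_two] at e
      rw [pow_succ, e]
      simp [mul_assoc]
    · apply hpow 2 (by omega) (by omega)
      simpa [wordProd_cons, pow_two, mul_assoc] using e
    · apply hpow 1 (by omega) (by omega)
      simpa [wordProd_cons, mul_assoc] using e

theorem isRightDescent_of_length_eq {w x : W} {i : B} (hw : w = x * cs.simple i)
    (hl : cs.length w = cs.length x + 1) : cs.IsRightDescent w i := by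
  subst hw
  rw [IsRightDescent, simple_mul_simple_cancel_right]
  omega

/-- If `i` and `k` commute and both have braid exponent at least `4` with `j`, then no `w` has a
reduced word ending in `k` and another ending in `i, j`. -/
theorem not_isRightDescent_of_eq_mul_two {i j k : B}
    (hik : Commute (cs.simple i) (cs.simple k)) (hne : cs.simple i ≠ cs.simple k)
    (hji : orderOf (cs.simple j * cs.simple i) = 0 ∨ 4 ≤ orderOf (cs.simple j * cs.simple i))
    (hjk : orderOf (cs.simple j * cs.simple k) = 0 ∨ 4 ≤ orderOf (cs.simple j * cs.simple k))
    {w x : W} (hw : w = x * cs.wordProd [i, j]) (hl : cs.length w = cs.length x + 2) :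
    ¬ cs.IsRightDescent w k := by
  intro hk
  induction hn : cs.length w using Nat.strong_induction_on generalizing w x i k with
  | _ n ih =>
    subst hn
    have hwj : w * cs.simple j = x * cs.simple i := by simp [hw, wordProd_cons, mul_assoc]
    have h₁ := cs.length_mul_le x (cs.simple i)
    have h₂ := cs.length_mul_simple w j
    rw [length_simple] at h₁
    rw [hwj] at h₂
    have hj : cs.IsRightDescent w j := by rw [IsRightDescent, hwj]; omega
    have hkj : orderOf (cs.simple k * cs.simple j) = orderOf (cs.simple j * cs.simple k) := by
      rw [← orderOf_inv]; simp
    obtain ⟨y, hy, hyl⟩ := cs.exists_eq_mul_four_of_isRightDescent (hkj ▸ hjk) hk hj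
    have hi' : cs.IsRightDescent (w * cs.simple j) i :=
      cs.isRightDescent_of_length_eq hwj (by rw [hwj]; omega)
    have hwjk : w * cs.simple j * cs.simple k = y * cs.wordProd [k, j] := by
      simp [hy, wordProd_cons, mul_assoc]
    have h₃ := cs.length_mul_le y (cs.wordProd [k, j])
    have h₄ := cs.length_wordProd_le [k, j]
    rw [← hwjk] at h₃
    simp only [List.length_cons, List.length_nil] at h₄
    have h₅ := cs.length_mul_simple (w * cs.simple j) k
    rw [hwj] at h₅ h₃
    have hk' : cs.IsRightDescent (w * cs.simple j) k := by rw [IsRightDescent, hwj]; omega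
    obtain ⟨z, hz, hzl⟩ := cs.exists_eq_mul_two_of_isRightDescent hne hi' hk'
    have hwz : w * cs.simple j * cs.simple k = z * cs.simple i := by
      simp [hz, wordProd_cons, mul_assoc]
    have hlen : cs.length (w * cs.simple j * cs.simple k) + 2 = cs.length w := by
      rw [hwj]; omega
    refine ih _ (by omega) hik.symm hne.symm hjk hji hwjk (by omega) ?_ rfl
    refine cs.isRightDescent_of_length_eq hwz ?_
    rw [hwj] at hzl hlen ⊢
    omega

end CoxeterSystem

/-- Corollary 4.2: if `m_{sr}, m_{st} ≥ 4`, there is no `w ∈ W` with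
`w = (w₁)(t) = (w₂)(rs)`. -/
theorem no_element_t_and_rs
{W : Type*} [Group W] {M : CoxeterMatrix (Fin 3)} (cs : CoxeterSystem M W)
    (r s t : W) (hr : r = cs.simple 0) (hs : s = cs.simple 1) (ht : t = cs.simple 2)
    (hrt : orderOf (r * t) = 2)
    (hsr : orderOf (s * r) = 0 ∨ 4 ≤ orderOf (s * r))
    (hst : orderOf (s * t) = 0 ∨ 4 ≤ orderOf (s * t)) :
    ¬ ∃ w w1 w2 : W,
        w = w1 * t ∧ cs.length w = cs.length w1 + 1 ∧
        w = w2 * r * s ∧ cs.length w = cs.length w2 + 2 := by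
  subst hr hs ht
  rintro ⟨w, w₁, w₂, h₁, hl₁, h₂, hl₂⟩
  have hcomm : Commute (cs.simple 0) (cs.simple 2) := by
    have h := pow_orderOf_eq_one (cs.simple 0 * cs.simple 2)
    rw [hrt, pow_two, mul_eq_one_iff_eq_inv] at h
    simpa [Commute, SemiconjBy] using h
  have hne : cs.simple 0 ≠ cs.simple 2 := fun h ↦ by simp [h] at hrt
  exact cs.not_isRightDescent_of_eq_mul_two hcomm hne hsr hst
    (by simpa [CoxeterSystem.wordProd_cons, mul_assoc] using h₂) hl₂
    (cs.isRightDescent_of_length_eq h₁ hl₁)
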